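/- If β ≻ α coordinatewise (β₁ > α₁ and β₂ > α₂), then the only multiplier from D_α to D_β is the zero function: M(D_α, D_β) = {0}. -/

import Mathlib

open scoped BigOperators

/-- The open unit disc in ℂ. -/
def UnitDisc : Set ℂ := {z : ℂ | ‖z‖ < 1}

/-- The open unit bidisc in ℂ². -/
def UnitBidisc : Set (ℂ × ℂ) := {p : ℂ × ℂ | ‖p.1‖ < 1 ∧ ‖p.2‖ < 1}

/-- `a` is the double power series coefficient sequence of `f` on the bidisc. -/
def IsCoeff (f : ℂ × ℂ → ℂ) (a : ℕ → ℕ → ℂ) : Prop :=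
  ∀ p ∈ UnitBidisc,
    HasSum (fun kl : ℕ × ℕ => a kl.1 kl.2 * p.1 ^ kl.1 * p.2 ^ kl.2) (f p)

/-- Weighted squared-coefficient summand for the bidisc Dirichlet type space. -/
noncomputable def wt (a1 a2 : ℝ) (a : ℕ → ℕ → ℂ) (kl : ℕ × ℕ) : ℝ :=
  ‖a kl.1 kl.2‖ ^ 2 * ((kl.1 : ℝ) + 1) ^ a1 * ((kl.2 : ℝ) + 1) ^ a2

/-- Membership in the Dirichlet type space `D_{(a1,a2)}` on the bidisc. -/
def MemD (a1 a2 : ℝ) (f : ℂ × ℂ → ℂ) : Prop :=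
  ∃ a : ℕ → ℕ → ℂ, IsCoeff f a ∧ Summable (wt a1 a2 a)

/-- `b` is the power series coefficient sequence of `g` on the unit disc. -/
def IsCoeff1 (g : ℂ → ℂ) (b : ℕ → ℂ) : Prop :=
  ∀ z ∈ UnitDisc, HasSum (fun k : ℕ => b k * z ^ k) (g z)

/-- Weighted squared-coefficient summand for the one-variable Dirichlet type space. -/
noncomputable def wt1 (a : ℝ) (b : ℕ → ℂ) (k : ℕ) : ℝ :=
  ‖b k‖ ^ 2 * ((k : ℝ) + 1) ^ a

/-- Membership in the one-variable Dirichlet type space `D_a` on the unit disc. -/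
def MemD1 (a : ℝ) (g : ℂ → ℂ) : Prop :=
  ∃ b : ℕ → ℂ, IsCoeff1 g b ∧ Summable (wt1 a b)

/-- `φ` is a multiplier from `D_{(a1,a2)}` to `D_{(b1,b2)}` on the bidisc. -/
def MemM (a1 a2 b1 b2 : ℝ) (φ : ℂ × ℂ → ℂ) : Prop :=
  ∀ f : ℂ × ℂ → ℂ, MemD a1 a2 f → MemD b1 b2 (fun p => φ p * f p)

/-- `φ` is a multiplier from `D_a` to `D_b` on the unit disc. -/
def MemM1 (a b : ℝ) (φ : ℂ → ℂ) : Prop :=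
  ∀ g : ℂ → ℂ, MemD1 a g → MemD1 b (fun z => φ z * g z)

/-- The norm of the evaluation functional at `(z,w)` on `D_{(g1,g2)}`. -/
noncomputable def evalNorm (g1 g2 : ℝ) (z w : ℂ) : ℝ :=
  Real.sqrt (∑' kl : ℕ × ℕ,
    ‖z‖ ^ (2 * kl.1) * ‖w‖ ^ (2 * kl.2) *
      ((kl.1 : ℝ) + 1) ^ (-g1) * ((kl.2 : ℝ) + 1) ^ (-g2))

open Filter

/-- A one-variable power series vanishing on the unit disc has zero coefficients. -/
lemma coeff_eq_zero_of_hasSum_zero {c : ℕ → ℂ}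
    (h : ∀ z ∈ UnitDisc, HasSum (fun k => c k * z ^ k) 0) (k : ℕ) : c k = 0 := by
  have hps : HasFPowerSeriesAt (0 : ℂ → ℂ) (FormalMultilinearSeries.ofScalars ℂ c) 0 := by
    rw [hasFPowerSeriesAt_iff]
    filter_upwards [Metric.ball_mem_nhds (0 : ℂ) one_pos] with z hz
    have hz' : z ∈ UnitDisc := by simpa [UnitDisc] using hz
    simpa [mul_comm, FormalMultilinearSeries.coeff_ofScalars] using h z hz'
  rw [← FormalMultilinearSeries.coeff_ofScalars (𝕜 := ℂ) (p := c) (n := k), hps.eq_zero]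
  rfl

lemma IsCoeff.eq_zero {c : ℕ → ℕ → ℂ} (h : IsCoeff 0 c) (k l : ℕ) : c k l = 0 := by
  have hfiber : ∀ p ∈ UnitBidisc, ∀ m,
      Summable (fun n => c m n * p.1 ^ m * p.2 ^ n) := fun p hp m =>
    (h p hp).summable.comp_injective (i := fun n => (m, n)) fun x y hxy => by simpa using hxy
  have hrow : ∀ w ∈ UnitDisc, ∀ m, Summable (fun n => c m n * w ^ n) := by
    intro w hw m
    have hs := hfiber ((1 / 2 : ℂ), w) ⟨by norm_num, hw⟩ m
    have h2 : ((1 / 2 : ℂ)) ^ m ≠ 0 := by simp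
    refine (summable_mul_right_iff h2).mp (hs.congr fun n => ?_)
    ring
  refine coeff_eq_zero_of_hasSum_zero (c := c k) (fun w hw => ?_) l
  have hsum : (∑' n, c k n * w ^ n) = 0 := by
    refine coeff_eq_zero_of_hasSum_zero (c := fun m => ∑' n, c m n * w ^ n) (fun z hz => ?_) k
    refine (h (z, w) ⟨hz, hw⟩).prod_fiberwise fun m => ?_
    have hm := (hrow w hw m).hasSum.mul_right (z ^ m)
    exact hm.congr_fun fun n => by ring
  simpa [hsum] using (hrow w hw k).hasSum

lemma IsCoeff.unique {f : ℂ × ℂ → ℂ} {a b : ℕ → ℕ → ℂ} (ha : IsCoeff f a)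
    (hb : IsCoeff f b) : a = b := by
  have h : IsCoeff 0 (fun k l => a k l - b k l) := fun p hp => by
    have := (ha p hp).sub (hb p hp)
    simpa [sub_mul] using this
  ext k l
  exact sub_eq_zero.mp (h.eq_zero k l)

/-- Coefficients of the product of a double power series with `∑ eₙ zⁿ wⁿ`. -/
noncomputable def diagConv (a : ℕ → ℕ → ℂ) (e : ℕ → ℂ) (m l : ℕ) : ℂ :=
  ∑ n ∈ Finset.range (m + 1), if n ≤ l then a (m - n) (l - n) * e n else 0

lemma isCoeff_mul_diag {φ : ℂ × ℂ → ℂ} {a : ℕ → ℕ → ℂ} {e : ℕ → ℂ} (ha : IsCoeff φ a)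
    (he : ∀ t ∈ UnitDisc, Summable fun n => ‖e n * t ^ n‖) :
    IsCoeff (fun p => φ p * ∑' n, e n * (p.1 * p.2) ^ n) (diagConv a e) := by
  intro p hp
  have ht : p.1 * p.2 ∈ UnitDisc := by
    have := mul_lt_one_of_nonneg_of_lt_one_left (norm_nonneg p.1) hp.1 hp.2.le
    simpa [UnitDisc] using this
  have hs := summable_mul_of_summable_norm (ha p hp).summable.norm (he _ ht)
  have hmul := (ha p hp).mul (he _ ht).of_norm.hasSum hs
  let i : (ℕ × ℕ) × ℕ → (ℕ × ℕ) × ℕ := fun x => ((x.1.1 + x.2, x.1.2 + x.2), x.2)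
  have hi : Function.Injective i := by
    rintro ⟨⟨x, y⟩, n⟩ ⟨⟨x', y'⟩, n'⟩ h
    simp only [i, Prod.mk.injEq] at h ⊢
    omega
  let G : (ℕ × ℕ) × ℕ → ℂ := fun x =>
    (if x.2 ≤ x.1.1 then if x.2 ≤ x.1.2 then a (x.1.1 - x.2) (x.1.2 - x.2) * e x.2 else 0 else 0)
      * p.1 ^ x.1.1 * p.2 ^ x.1.2
  have hG : HasSum G (φ p * ∑' n, e n * (p.1 * p.2) ^ n) := by
    rw [← hi.hasSum_iff]
    · refine hmul.congr_fun fun x => ?_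
      simp only [Function.comp, G, i, le_add_iff_nonneg_left, zero_le, if_true,
        Nat.add_sub_cancel]
      ring
    · rintro ⟨⟨x, y⟩, n⟩ hx
      simp only [G]
      split_ifs with h1 h2
      · exact absurd ⟨((x - n, y - n), n), by simp [i, h1, h2]⟩ hx
      all_goals simp
  refine hG.prod_fiberwise fun ml => ?_
  have hfin := hasSum_sum_of_ne_finset_zero (f := fun n => G (ml, n)) (L := .unconditional ℕ)
    (s := Finset.range (ml.1 + 1)) fun n hn => by
      have : ¬ n ≤ ml.1 := by simpa [Nat.lt_succ_iff] using hn
      simp [G, this]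
  suffices h : diagConv a e ml.1 ml.2 * p.1 ^ ml.1 * p.2 ^ ml.2 =
      ∑ n ∈ Finset.range (ml.1 + 1), G (ml, n) from h ▸ hfin
  rw [diagConv, Finset.sum_mul, Finset.sum_mul]
  refine Finset.sum_congr rfl fun n hn => ?_
  have : n ≤ ml.1 := by simpa [Nat.lt_succ_iff] using hn
  simp [G, this]

lemma isCoeff_diag {e : ℕ → ℂ} (he : ∀ t ∈ UnitDisc, Summable fun n => ‖e n * t ^ n‖) :
    IsCoeff (fun p => ∑' n, e n * (p.1 * p.2) ^ n) (fun k l => if k = l then e k else 0) := by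
  intro p hp
  have ht : p.1 * p.2 ∈ UnitDisc := by
    have := mul_lt_one_of_nonneg_of_lt_one_left (norm_nonneg p.1) hp.1 hp.2.le
    simpa [UnitDisc] using this
  have hi : Function.Injective fun n : ℕ => (n, n) := fun x y h => by simpa using h
  rw [← hi.hasSum_iff]
  · refine (he _ ht).of_norm.hasSum.congr_fun fun n => ?_
    simp [mul_pow, mul_assoc]
  · rintro ⟨k, l⟩ hkl
    have : k ≠ l := by
      rintro rfl
      exact hkl ⟨k, rfl⟩
    simp [this]

/-- Signed copy of `c` whose signs prevent cancellation in the Cauchy product with `u`. -/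
noncomputable def signSeq (u : ℕ → ℂ) (c : ℕ → ℝ) (n : ℕ) : ℂ :=
  if c n * ‖u 0‖ ≤ ‖(∑ i : Fin n, signSeq u c i * u (n - i)) + c n * u 0‖ then c n else -c n
termination_by n
decreasing_by exact i.2

lemma norm_signSeq (u : ℕ → ℂ) {c : ℕ → ℝ} (hc : ∀ n, 0 ≤ c n) (n : ℕ) :
    ‖signSeq u c n‖ = c n := by
  rw [signSeq]
  split_ifs <;> simp [abs_of_nonneg (hc n)]

lemma le_norm_sum_signSeq (u : ℕ → ℂ) {c : ℕ → ℝ} (hc : ∀ n, 0 ≤ c n) (n : ℕ) :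
    c n * ‖u 0‖ ≤ ‖∑ i ∈ Finset.range (n + 1), signSeq u c i * u (n - i)‖ := by
  rw [Finset.sum_range_succ, signSeq.eq_1 u c n, Nat.sub_self,
    Finset.sum_range (fun i => signSeq u c i * u (n - i))]
  split_ifs with h
  · exact h
  · set y := ∑ i : Fin n, signSeq u c i * u (n - i)
    have hsub : (y + c n * u 0) - (y + -c n * u 0) = 2 * (c n * u 0) := by ring
    have htri := norm_sub_le (y + c n * u 0) (y + -c n * u 0)
    rw [hsub] at htri
    simp only [norm_mul, Complex.norm_real, Real.norm_eq_abs, abs_of_nonneg (hc n),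
      RCLike.norm_ofNat] at htri
    linarith [not_le.mp h]

lemma exists_pos_mul_rpow_le_rpow_add (b : ℝ) (j : ℕ) :
    ∃ K > 0, ∀ n : ℕ, K * ((n : ℝ) + 1) ^ b ≤ (((j + n : ℕ) : ℝ) + 1) ^ b := by
  rcases le_or_gt 0 b with hb | hb
  · refine ⟨1, one_pos, fun n => ?_⟩
    rw [one_mul]
    refine Real.rpow_le_rpow (by positivity) ?_ hb
    push_cast
    linarith [(Nat.cast_nonneg j : (0 : ℝ) ≤ j)]
  · refine ⟨((j : ℝ) + 1) ^ b, by positivity, fun n => ?_⟩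
    rw [← Real.mul_rpow (by positivity) (by positivity)]
    refine Real.rpow_le_rpow_of_nonpos (by positivity) ?_ hb.le
    push_cast
    nlinarith [mul_nonneg (Nat.cast_nonneg j : (0 : ℝ) ≤ j) (Nat.cast_nonneg n : (0 : ℝ) ≤ n)]

lemma summable_norm_mul_pow_of_norm_eq_rpow {e : ℕ → ℂ} {s : ℝ}
    (he : ∀ n, ‖e n‖ = ((n : ℝ) + 1) ^ s) {t : ℂ} (ht : t ∈ UnitDisc) :
    Summable fun n => ‖e n * t ^ n‖ := by
  obtain ⟨N, hN⟩ := exists_nat_ge s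
  refine summable_norm_mul_geometric_of_norm_lt_one' (k := N) ht ?_
  refine Asymptotics.IsBigO.of_bound (2 ^ N) ?_
  filter_upwards [eventually_ge_atTop 1] with n hn
  have hn' : (1 : ℝ) ≤ n := by exact_mod_cast hn
  rw [he]
  calc ((n : ℝ) + 1) ^ s ≤ ((n : ℝ) + 1) ^ (N : ℝ) :=
        Real.rpow_le_rpow_of_exponent_le (by linarith) hN
    _ = ((n : ℝ) + 1) ^ N := Real.rpow_natCast _ _
    _ ≤ (2 * n) ^ N := by gcongr; linarith
    _ = 2 ^ N * ‖((n ^ N : ℕ) : ℂ)‖ := by simp [mul_pow]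

lemma memD_one (a1 a2 : ℝ) : MemD a1 a2 fun _ => 1 := by
  refine ⟨fun k l => if (k, l) = (0, 0) then 1 else 0, fun p _ => ?_, ?_⟩
  · have h := hasSum_single (f := fun kl : ℕ × ℕ =>
      (if (kl.1, kl.2) = (0, 0) then (1 : ℂ) else 0) * p.1 ^ kl.1 * p.2 ^ kl.2) (0, 0)
      fun kl hkl => by rw [if_neg hkl]; simp
    simpa using h
  · refine summable_of_ne_finset_zero (s := {(0, 0)}) fun kl hkl => ?_
    have : (kl.1, kl.2) ≠ (0, 0) := by simpa using hkl
    simp only [wt, if_neg this]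
    simp

lemma memD_diag {a1 a2 s : ℝ} (hs : 2 * s + a1 + a2 < -1) {e : ℕ → ℂ}
    (he : ∀ n, ‖e n‖ = ((n : ℝ) + 1) ^ s) :
    MemD a1 a2 fun p => ∑' n, e n * (p.1 * p.2) ^ n := by
  refine ⟨_, isCoeff_diag fun t ht => summable_norm_mul_pow_of_norm_eq_rpow he ht, ?_⟩
  have hi : Function.Injective fun n : ℕ => (n, n) := fun x y h => by simpa using h
  rw [← hi.summable_iff]
  · have h := (summable_nat_add_iff 1).mpr (Real.summable_nat_rpow.mpr hs)
    refine h.congr fun n => ?_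
    have hn : (0 : ℝ) < (n : ℝ) + 1 := by positivity
    simp only [Function.comp, wt, if_true, he]
    rw [← Real.rpow_natCast, ← Real.rpow_mul hn.le, ← Real.rpow_add hn, ← Real.rpow_add hn]
    push_cast
    ring_nf
  · rintro ⟨k, l⟩ hkl
    have : k ≠ l := by
      rintro rfl
      exact hkl ⟨k, rfl⟩
    simp [wt, this]

/-- if `β ≻ α` then `M(D_α, D_β) = {0}`. -/
theorem stmt15 (a1 a2 b1 b2 : ℝ) (h1 : a1 < b1) (h2 : a2 < b2)
    (φ : ℂ × ℂ → ℂ) (hφ : MemM a1 a2 b1 b2 φ) :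
    ∀ p ∈ UnitBidisc, φ p = 0 := by
  obtain ⟨a, ha, -⟩ := hφ _ (memD_one a1 a2)
  simp only [mul_one] at ha
  by_contra! hne
  obtain ⟨p, hp, hpne⟩ := hne
  have hex : ∃ j k, a j k ≠ 0 := by
    by_contra! hzero
    refine hpne ((ha p hp).unique ?_)
    simp [hzero]
  classical
  let j := Nat.find hex
  obtain ⟨k, hjk⟩ : ∃ k, a j k ≠ 0 := Nat.find_spec hex
  have hmin : ∀ m < j, ∀ l, a m l = 0 := fun m hm l => by
    by_contra hml
    exact Nat.find_min hex hm ⟨l, hml⟩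
  let s : ℝ := -(1 + b1 + b2) / 2
  let c : ℕ → ℝ := fun n => ((n : ℝ) + 1) ^ s
  let u : ℕ → ℂ := fun n => a (j + n) (k + n)
  have hc : ∀ n, 0 ≤ c n := fun n => by positivity
  have he : ∀ n, ‖signSeq u c n‖ = ((n : ℝ) + 1) ^ s := norm_signSeq u hc
  obtain ⟨b, hb, hsum⟩ := hφ _ (memD_diag (a1 := a1) (a2 := a2) (by simp only [s]; linarith) he)
  have hbconv : b = diagConv a (signSeq u c) :=
    hb.unique (isCoeff_mul_diag ha fun t ht => summable_norm_mul_pow_of_norm_eq_rpow he ht)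
  have hdiag : ∀ n, b (j + n) (k + n) =
      ∑ i ∈ Finset.range (n + 1), signSeq u c i * u (n - i) := by
    intro n
    rw [hbconv, diagConv]
    symm
    rw [← Finset.sum_subset (Finset.range_mono (show n + 1 ≤ j + n + 1 by omega))]
    · refine Finset.sum_congr rfl fun i hi => ?_
      have hin : i ≤ n := by simpa [Nat.lt_succ_iff] using hi
      rw [if_pos (by omega), Nat.add_sub_assoc hin, Nat.add_sub_assoc hin, mul_comm]
    · intro i hi hin
      simp only [Finset.mem_range] at hi hin
      rw [hmin (j + n - i) (by omega)]
      simp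
  obtain ⟨K₁, hK₁, hb1⟩ := exists_pos_mul_rpow_le_rpow_add b1 j
  obtain ⟨K₂, hK₂, hb2⟩ := exists_pos_mul_rpow_le_rpow_add b2 k
  have hsum' : Summable fun n => wt b1 b2 b (j + n, k + n) :=
    hsum.comp_injective (i := fun n => (j + n, k + n)) fun x y hxy => by simpa using hxy
  have hK : ‖a j k‖ ^ 2 * K₁ * K₂ ≠ 0 := by positivity
  have hharm : Summable fun n : ℕ => ‖a j k‖ ^ 2 * K₁ * K₂ * (1 / ((n + 1 : ℕ) : ℝ)) := by
    refine Summable.of_nonneg_of_le (fun n => by positivity) (fun n => ?_) hsum'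
    have hn : (0 : ℝ) < (n : ℝ) + 1 := by positivity
    have hcn : (1 / ((n + 1 : ℕ) : ℝ)) = c n ^ 2 * ((n : ℝ) + 1) ^ b1 * ((n : ℝ) + 1) ^ b2 := by
      simp only [c]
      rw [← Real.rpow_natCast, ← Real.rpow_mul hn.le, ← Real.rpow_add hn, ← Real.rpow_add hn,
        show s * (2 : ℕ) + b1 + b2 = -1 by simp only [s]; push_cast; ring, Real.rpow_neg_one]
      push_cast
      rw [one_div]
    have hle : c n * ‖a j k‖ ≤ ‖b (j + n) (k + n)‖ := by
      rw [hdiag]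
      exact le_norm_sum_signSeq u hc n
    calc ‖a j k‖ ^ 2 * K₁ * K₂ * (1 / ((n + 1 : ℕ) : ℝ))
        = (c n * ‖a j k‖) ^ 2 * (K₁ * ((n : ℝ) + 1) ^ b1) * (K₂ * ((n : ℝ) + 1) ^ b2) := by
          rw [hcn]; ring
      _ ≤ wt b1 b2 b (j + n, k + n) := by
          have := hc n
          simp only [wt]
          gcongr
          · exact hb1 n
          · exact hb2 n
  rw [summable_mul_left_iff hK] at hharm
  exact Real.not_summable_one_div_natCast ((summable_nat_add_iff 1).mp hharm)
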